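/- arXiv:2505.05210 — 2 statements merged into one kernel-verified Lean document; each statement's English description precedes it below -/
import Mathlib

section
/- For every p with 0 < p < 1/2 and every real β with 0 < β < (1/2 − p)², there exists D such that for all d ≥ D and all integers k with 1 ≤ k ≤ ⌊(d+1)/2⌋, the inequality (d+1 choose k) · exp(−2·k·(d+1−k)·(1/2 − p)²) ≤ exp(−β·k·d) holds. (This is the uniform-in-k bound showing that the union bound over all k-lines, with the Hoeffding tail for each distance-k(d+1−k) repetition code, decays at rate e^{−Ω(kd)}.) -/
/-- A linear function is dominated by any growing exponential, with an explicit threshold. -/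
theorem le_exp_mul_of_two_div_sq_le {γ x : ℝ} (hγ : 0 < γ) (hx : 2 / γ ^ 2 ≤ x) :
    x ≤ Real.exp (γ * x) := by
  have hx0 : 0 ≤ x := le_trans (by positivity) hx
  have hexp := Real.quadratic_le_exp_of_nonneg (mul_nonneg hγ.le hx0)
  rw [div_le_iff₀ (by positivity)] at hx
  nlinarith [mul_nonneg hγ.le hx0, mul_le_mul_of_nonneg_right hx hx0]

theorem union_bound_uniform_in_k (p β : ℝ) (hp0 : 0 < p) (hp1 : p < 1/2)
    (hβ0 : 0 < β) (hβ : β < (1/2 - p)^2) :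
    ∃ D : ℕ, ∀ d : ℕ, D ≤ d → ∀ k : ℕ, 1 ≤ k → k ≤ (d+1)/2 →
      ((d+1).choose k : ℝ) *
          Real.exp (-(2 * k * ((d : ℝ) + 1 - k) * (1/2 - p)^2))
        ≤ Real.exp (-(β * k * d)) := by
  set c := (1/2 - p)^2
  obtain ⟨D, hD⟩ := exists_nat_ge (2 / (c - β) ^ 2)
  refine ⟨D, fun d hd k _ hk => ?_⟩
  have hdD : (D : ℝ) ≤ d := by exact_mod_cast hd
  have hk2 : 2 * (k : ℝ) ≤ d + 1 := by
    have : 2 * k ≤ d + 1 := by omega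
    exact_mod_cast this
  have hn : (d : ℝ) + 1 ≤ Real.exp ((c - β) * (d + 1)) :=
    le_exp_mul_of_two_div_sq_le (sub_pos.2 hβ) (by linarith)
  have hchoose : ((d+1).choose k : ℝ) ≤ Real.exp (k * ((c - β) * (d + 1))) := by
    rw [Real.exp_nat_mul]
    calc ((d+1).choose k : ℝ) ≤ ((d : ℝ) + 1) ^ k := by
          exact_mod_cast Nat.choose_le_pow (d + 1) k
      _ ≤ _ := by gcongr
  calc _ ≤ Real.exp (k * ((c - β) * (d + 1))) *
          Real.exp (-(2 * k * ((d : ℝ) + 1 - k) * c)) := by gcongr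
    _ ≤ _ := by
      rw [← Real.exp_add, Real.exp_le_exp]
      have hkc : 0 ≤ k * c := mul_nonneg k.cast_nonneg (hβ0.trans hβ).le
      have hkβ : 0 ≤ k * β := mul_nonneg k.cast_nonneg hβ0.le
      nlinarith [mul_nonneg hkc (sub_nonneg.2 hk2)]
end

section
/- Let d ≥ 1 and let C be any set of edges of the complete graph on Fin(d+1). Then there exists a set S of vertices such that the corrected set C' = C △ cut(S) satisfies 2·|C' ∩ L_v| ≤ d for every vertex v. (This is the termination/correctness of the post-processing algorithm: repeatedly toggling 1-lines converges to a correction whose overlap with every 1-line is less than ⌈(d+1)/2⌉, and the net effect of the toggles is the symmetric difference with a single cut.) -/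
open scoped Classical
open Finset

noncomputable section

/-- The edges of the complete graph on `Fin (d+1)`: non-diagonal unordered pairs. -/
def Edges (d : ℕ) : Finset (Sym2 (Fin (d+1))) :=
  Finset.univ.filter (fun e => ¬ e.IsDiag)

/-- The cut `cut S`: edges with exactly one endpoint in `S`. -/
def cut (d : ℕ) (S : Finset (Fin (d+1))) : Finset (Sym2 (Fin (d+1))) :=
  (Edges d).filter (fun e => (S.filter (fun v => v ∈ e)).card = 1)

/-- The qubit line (1-line) `L_v`: the star of the vertex `v`, i.e. the `d` edges
incident to `v`. -/
def star (d : ℕ) (v : Fin (d+1)) : Finset (Sym2 (Fin (d+1))) :=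
  (Edges d).filter (fun e => v ∈ e)

open scoped symmDiff

theorem mk_mem_cut {d : ℕ} {S : Finset (Fin (d+1))} {a b : Fin (d+1)} :
    s(a, b) ∈ cut d S ↔ a ≠ b ∧ ¬ (a ∈ S ↔ b ∈ S) := by
  simp only [cut, Edges, mem_filter, mem_univ, true_and, Sym2.mk_isDiag_iff, Sym2.mem_iff]
  refine and_congr_right fun hab => ?_
  rw [filter_or, card_union_of_disjoint
    (disjoint_filter.2 fun x _ hxa hxb => hab (hxa.symm.trans hxb)), filter_eq', filter_eq']
  by_cases ha : a ∈ S <;> by_cases hb : b ∈ S <;> simp [ha, hb]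

/-- Toggling a vertex in `S` toggles its star in `cut S`. -/
theorem cut_symmDiff_singleton (d : ℕ) (S : Finset (Fin (d+1))) (v : Fin (d+1)) :
    cut d (S ∆ {v}) = cut d S ∆ star d v := by
  ext e
  induction e with
  | _ a b =>
    have hstar : s(a, b) ∈ star d v ↔ a ≠ b ∧ (v = a ∨ v = b) := by simp [_root_.star, Edges]
    simp only [mem_symmDiff, mk_mem_cut, hstar, mem_singleton]
    grind

theorem card_star_le (d : ℕ) (v : Fin (d+1)) : (star d v).card ≤ d := by
  have hsub : star d v ⊆ (univ.erase v).image (fun w => s(v, w)) := by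
    intro e he
    obtain ⟨hdiag, w, rfl⟩ : ¬ e.IsDiag ∧ v ∈ e := by simpa [_root_.star, Edges] using he
    exact mem_image.2 ⟨w, by simpa [eq_comm] using hdiag, rfl⟩
  calc (star d v).card ≤ _ := card_le_card hsub
    _ ≤ (univ.erase v).card := card_image_le
    _ = d := by simp

theorem two_mul_card_inter_le_of_card_le_symmDiff {α : Type*} [DecidableEq α] {D L : Finset α}
    (h : D.card ≤ (D ∆ L).card) : 2 * (D ∩ L).card ≤ L.card := by
  have hDL : (D ∆ L).card = (D \ L).card + (L \ D).card :=
    card_union_of_disjoint disjoint_sdiff_sdiff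
  have hD := card_sdiff_add_card_inter D L
  have hL := card_sdiff_add_card_inter L D
  rw [inter_comm] at hL
  lia

theorem post_processing_terminates (d : ℕ) (hd : 1 ≤ d)
    (C : Finset (Sym2 (Fin (d+1)))) (hC : C ⊆ Edges d) :
    ∃ S : Finset (Fin (d+1)),
      ∀ v : Fin (d+1), 2 * ((C ∆ cut d S) ∩ star d v).card ≤ d := by
  obtain ⟨S, -, hS⟩ := exists_min_image (univ : Finset (Finset (Fin (d+1))))
    (fun S => (C ∆ cut d S).card) univ_nonempty
  refine ⟨S, fun v => (two_mul_card_inter_le_of_card_le_symmDiff ?_).trans (card_star_le d v)⟩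
  rw [symmDiff_assoc, ← cut_symmDiff_singleton]
  exact hS _ (mem_univ _)
end
end
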